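/- arXiv:2007.11169 — 3 statements merged into one kernel-verified Lean document; each statement's English description precedes it below -/
import Mathlib

section
/- Let q be a prime power and n a natural number. If there exists a primitive 2-normal element in F_{q^n} over F_q, then n ≥ 4; moreover, if n = 4 then q ≡ 1 (mod 4). -/
open Polynomial

noncomputable section

/-- An element of a finite field is *primitive* if it generates the cyclic multiplicative
group, i.e. its multiplicative order is `card E - 1`. -/
def IsPrimitiveElem {E : Type*} [Field E] [Fintype E] (α : E) : Prop :=
  orderOf α = Fintype.card E - 1

/-- The polynomial `g_α(x) = Σ_{i=0}^{n-1} α^{q^i} x^{n-1-i} ∈ F_{q^n}[x]`. -/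
def gPoly {E : Type*} [Field E] (q n : ℕ) (α : E) : Polynomial E :=
  ∑ i ∈ Finset.range n, C (α ^ q ^ i) * X ^ (n - 1 - i)

/-- `α ∈ F_{q^n}` is `k`-normal over `F_q` if `gcd(x^n - 1, g_α(x))` in `F_{q^n}[x]`
has degree `k`. -/
def IsKNormal {E : Type*} [Field E] (q n k : ℕ) (α : E) : Prop :=
  (@EuclideanDomain.gcd (Polynomial E) _ (Classical.decEq _)
    ((X : Polynomial E) ^ n - 1) (gPoly q n α)).natDegree = k

lemma linear_eq_zero_of_quadratic_dvd {E : Type*} [Field E] {f : Polynomial E} {a b : E}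
    (hf : f.natDegree = 2) (h : f ∣ C a * X + C b) : a = 0 ∧ b = 0 := by
  have h0 : C a * X + C b = 0 := by
    refine eq_zero_of_dvd_of_natDegree_lt h ?_
    have := natDegree_linear_le (a := a) (b := b)
    omega
  constructor
  · simpa using congrArg (fun p => p.coeff 1) h0
  · simpa using congrArg (fun p => p.coeff 0) h0

lemma IsPrimitiveElem.ne_zero {E : Type*} [Field E] [Fintype E] {α : E}
    (h : IsPrimitiveElem α) : α ≠ 0 := by
  rintro rfl
  have h1 : 1 < Fintype.card E := Fintype.one_lt_card
  have h2 := pow_orderOf_eq_one (0 : E)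
  rw [h, zero_pow (by omega)] at h2
  exact zero_ne_one h2

lemma IsPrimitiveElem.card_sub_one_le {E : Type*} [Field E] [Fintype E] {α : E}
    (h : IsPrimitiveElem α) {m : ℕ} (hm : 0 < m) (hα : α ^ m = 1) :
    Fintype.card E - 1 ≤ m := by
  rw [← h]
  exact Nat.le_of_dvd hm (orderOf_dvd_of_pow_eq_one hα)

lemma natDegree_gPoly_le {E : Type*} [Field E] (q n : ℕ) (α : E) :
    (gPoly q n α).natDegree ≤ n - 1 := by
  refine natDegree_sum_le_of_forall_le _ _ fun i _ => ?_
  exact (natDegree_C_mul_X_pow_le _ _).trans (Nat.sub_le _ _)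

lemma gPoly_ne_zero {E : Type*} [Field E] {q n : ℕ} (hn : 0 < n) {α : E} (hα : α ≠ 0) :
    gPoly q n α ≠ 0 := by
  intro h
  apply hα
  have h1 := congrArg (fun p => p.coeff (n - 1)) h
  simp only [gPoly, finsetSum_coeff, coeff_C_mul, coeff_X_pow, coeff_zero] at h1
  rw [Finset.sum_eq_single 0] at h1
  · simpa using h1
  · intro i hi h0
    rw [Finset.mem_range] at hi
    rw [if_neg (by omega), mul_zero]
  · intro h0
    exact absurd (Finset.mem_range.2 hn) h0

lemma IsKNormal.exists_dvd {E : Type*} [Field E] {q n k : ℕ} {α : E} (h : IsKNormal q n k α) :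
    ∃ d : Polynomial E, d ∣ X ^ n - 1 ∧ d ∣ gPoly q n α ∧ d.natDegree = k :=
  ⟨_, @EuclideanDomain.gcd_dvd_left _ _ (Classical.decEq _) _ _,
    @EuclideanDomain.gcd_dvd_right _ _ (Classical.decEq _) _ _, h⟩

lemma dvd_of_dvd_of_natDegree_eq {E : Type*} [Field E] {f g : Polynomial E} (hg : g ≠ 0)
    (h : f ∣ g) (hd : g.natDegree ≤ f.natDegree) : g ∣ f :=
  (associated_of_dvd_of_natDegree_le h hg hd).symm.dvd

lemma sub_pow_of_card_eq_pow {E : Type*} [Field E] [Fintype E] {q n : ℕ} (hq : IsPrimePow q)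
    (hE : Fintype.card E = q ^ n) (a b : E) : (a - b) ^ q = a ^ q - b ^ q := by
  obtain ⟨p, k, hp, hk, rfl⟩ := hq
  have hp : p.Prime := hp.nat_prime
  obtain ⟨r, hr⟩ := CharP.exists E
  obtain ⟨m, hr', hm⟩ := FiniteField.card E r
  have : r = p := by
    have h1 : r ∣ (p ^ k) ^ n := by
      rw [← hE, hm]
      exact dvd_pow_self _ m.ne_zero
    exact (Nat.prime_dvd_prime_iff_eq hr' hp).1
      (hr'.dvd_of_dvd_pow (hr'.dvd_of_dvd_pow h1))
  subst this
  have := Fact.mk hp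
  exact sub_pow_char_pow a b k

lemma charTwo_of_even_card {E : Type*} [Field E] [Fintype E] (h : 2 ∣ Fintype.card E) :
    CharP E 2 := by
  obtain ⟨r, hr⟩ := CharP.exists E
  obtain ⟨m, hr', hm⟩ := FiniteField.card E r
  rw [hm] at h
  have := (Nat.prime_dvd_prime_iff_eq Nat.prime_two hr').1 (Nat.prime_two.dvd_of_dvd_pow h)
  rwa [this]

lemma gPoly_four {E : Type*} [Field E] (q : ℕ) (α : E) :
    gPoly q 4 α = C α * X ^ 3 + C (α ^ q) * X ^ 2 + C (α ^ q ^ 2) * X + C (α ^ q ^ 3) := by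
  simp [gPoly, Finset.sum_range_succ]

lemma IsPrimitiveElem.not_isKNormal_three {E : Type*} [Field E] [Fintype E] {q : ℕ}
    (hq : 2 ≤ q) (hE : Fintype.card E = q ^ 3) {α : E} (hα : IsPrimitiveElem α) :
    ¬ IsKNormal q 3 2 α := by
  intro h
  obtain ⟨d, hd, hdg, hdeg⟩ := h.exists_dvd
  have hg : gPoly q 3 α = C α * X ^ 2 + C (α ^ q) * X + C (α ^ q ^ 2) := by
    simp [gPoly, Finset.sum_range_succ]
  have hrem : d ∣ C (α ^ q * α ^ q - α * α ^ q ^ 2) * X + C (α ^ q * α ^ q ^ 2 - α * α) := by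
    have h1 := (hd.mul_left (C α * C α)).sub (hdg.mul_left (C α * X - C (α ^ q)))
    rw [hg] at h1
    convert h1 using 1
    simp only [C_sub, C_mul]
    ring
  have h1 := (linear_eq_zero_of_quadratic_dvd hdeg hrem).1
  obtain ⟨s, rfl⟩ : ∃ s, q = s + 1 := ⟨q - 1, by omega⟩
  have h2 : α ^ (s ^ 2) = 1 := by
    have h3 : α ^ (2 * (s + 1)) ≠ 0 := pow_ne_zero _ hα.ne_zero
    apply mul_right_cancel₀ h3
    rw [one_mul, ← pow_add, show s ^ 2 + 2 * (s + 1) = 1 + (s + 1) ^ 2 by ring, pow_add, pow_one,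
      two_mul, pow_add α (s + 1)]
    exact (sub_eq_zero.1 h1).symm
  have h3 := hα.card_sub_one_le (pow_pos (by omega) 2) h2
  have h4 : (s + 1) ^ 3 = s ^ 3 + 3 * s ^ 2 + 3 * s + 1 := by ring
  rw [hE, h4] at h3
  have : 0 ≤ s ^ 3 := Nat.zero_le _
  have : 0 ≤ s ^ 2 := Nat.zero_le _
  omega

lemma IsPrimitiveElem.pow_two_mul_sq_sub_one_ne_one {E : Type*} [Field E] [Fintype E] {q : ℕ}
    (hq : 2 ≤ q) (hE : Fintype.card E = q ^ 4) {α : E} (hα : IsPrimitiveElem α) :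
    α ^ (2 * (q ^ 2 - 1)) ≠ 1 := by
  intro h
  have h4 : 4 ≤ q ^ 2 := by nlinarith
  have h1 := hα.card_sub_one_le (by omega) h
  rw [hE, show q ^ 4 = q ^ 2 * q ^ 2 by ring] at h1
  have : 4 * q ^ 2 ≤ q ^ 2 * q ^ 2 := by nlinarith
  omega

lemma IsPrimitiveElem.pow_sq_ne {E : Type*} [Field E] [Fintype E] {q : ℕ}
    (hq : 2 ≤ q) (hE : Fintype.card E = q ^ 4) {α : E} (hα : IsPrimitiveElem α) {u : E}
    (hu : u ^ 2 = 1) : α ^ q ^ 2 ≠ u * α := by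
  intro h
  apply hα.pow_two_mul_sq_sub_one_ne_one hq hE
  have h1 : α ^ (q ^ 2 - 1) = u := by
    apply mul_right_cancel₀ hα.ne_zero
    rw [← h, ← pow_succ, Nat.sub_add_cancel (Nat.one_le_pow _ _ (by omega))]
  rw [mul_comm, pow_mul, h1, hu]

lemma IsPrimitiveElem.not_dvd_gPoly_four {E : Type*} [Field E] [Fintype E] {q : ℕ}
    (hq : 2 ≤ q) (hE : Fintype.card E = q ^ 4) {α : E} (hα : IsPrimitiveElem α) {u : E}
    (hu : u ^ 2 = 1) : ¬ X ^ 2 - C u ∣ gPoly q 4 α := by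
  intro h
  have h1 : X ^ 2 - C u ∣ C (α ^ q ^ 2 + u * α) * X + C (α ^ q ^ 3 + u * α ^ q) := by
    have h2 := h.sub (dvd_mul_right (X ^ 2 - C u) (C α * X + C (α ^ q)))
    rw [gPoly_four] at h2
    convert h2 using 1
    simp only [C_add, C_mul]
    ring
  have h2 := (linear_eq_zero_of_quadratic_dvd (natDegree_X_pow_sub_C) h1).1
  refine hα.pow_sq_ne hq hE (u := -u) (by rw [neg_sq, hu]) ?_
  linear_combination h2

lemma IsPrimitiveElem.not_isKNormal_four_of_even {E : Type*} [Field E] [Fintype E] {q : ℕ}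
    (hq : 2 ≤ q) (hq2 : 2 ∣ q) (hE : Fintype.card E = q ^ 4) {α : E}
    (hα : IsPrimitiveElem α) : ¬ IsKNormal q 4 2 α := by
  intro h
  obtain ⟨d, hd, hdg, hdeg⟩ := h.exists_dvd
  have : CharP E 2 := charTwo_of_even_card (hE ▸ dvd_pow hq2 (by norm_num))
  have h2 : (2 : Polynomial E) = 0 := CharTwo.two_eq_zero
  have h4 : (X ^ 4 - 1 : Polynomial E) = (X - C 1) ^ 4 := by
    rw [C_1]
    linear_combination (-1 + 2 * X - 3 * X ^ 2 + 2 * X ^ 3) * h2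
  rw [h4] at hd
  obtain ⟨i, hi, hass⟩ := (dvd_prime_pow (prime_X_sub_C (1 : E)) _).1 hd
  have hdeg' := natDegree_eq_of_degree_eq (degree_eq_degree_of_associated hass)
  rw [hdeg, natDegree_pow, natDegree_X_sub_C, mul_one] at hdeg'
  subst hdeg'
  refine hα.not_dvd_gPoly_four hq hE (u := 1) (one_pow 2) ?_
  have h5 : (X ^ 2 - C 1 : Polynomial E) = (X - C 1) ^ 2 := by
    rw [C_1]
    linear_combination (X - 1) * h2
  rw [h5]
  exact hass.symm.dvd.trans hdg

lemma IsPrimitiveElem.not_isKNormal_four_of_mod_four_eq_three {E : Type*} [Field E] [Fintype E]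
    {q : ℕ} (hq : IsPrimePow q) (hq4 : q % 4 = 3) (hE : Fintype.card E = q ^ 4) {α : E}
    (hα : IsPrimitiveElem α) : ¬ IsKNormal q 4 2 α := by
  intro h
  obtain ⟨d, hd, hdg, hdeg⟩ := h.exists_dvd
  have hq2 : 2 ≤ q := hq.two_le
  set A : E := α ^ q ^ 2 - α with hA
  have hA0 : A ≠ 0 := fun h0 =>
    hα.pow_sq_ne hq2 hE (u := 1) (one_pow 2) (by rw [one_mul]; exact sub_eq_zero.1 h0)
  have hB : A ^ q = α ^ q ^ 3 - α ^ q := by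
    rw [hA, sub_pow_of_card_eq_pow hq hE, ← pow_mul, ← pow_succ]
  have hBq : (A ^ q) ^ q = -A := by
    rw [hB, sub_pow_of_card_eq_pow hq hE, ← pow_mul, ← pow_succ, ← pow_mul, ← sq, ← hE,
      FiniteField.pow_card, hA, neg_sub]
  have hchar : (-1 : E) ≠ 1 := by
    have : ringChar E ≠ 2 := by
      intro h2
      have h3 : 2 ∣ q ^ 4 := by
        rw [← hE, ← h2]
        exact ringChar.dvd (FiniteField.cast_card_eq_zero E)
      have := Nat.prime_two.dvd_of_dvd_pow h3
      omega
    exact Ring.neg_one_ne_one_of_char_ne_two this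
  have hS : A ^ 2 + (A ^ q) ^ 2 ≠ 0 := by
    intro h0
    obtain ⟨m, rfl⟩ : ∃ m, q = 4 * m + 3 := ⟨q / 4, by omega⟩
    have h1 : (A ^ (4 * m + 2)) ^ 2 = -1 := by
      apply mul_right_cancel₀ (pow_ne_zero 2 hA0)
      linear_combination h0
    have h2 : A ^ ((4 * m + 3) * (4 * m + 3) - 1) = -1 := by
      apply mul_right_cancel₀ hA0
      rw [← pow_succ, Nat.sub_add_cancel (by nlinarith), pow_mul, hBq, neg_one_mul]
    apply hchar
    rw [← h2, show (4 * m + 3) * (4 * m + 3) - 1 = (4 * m + 2) * 2 * (2 * (m + 1)) by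
      rw [Nat.sub_eq_iff_eq_add (by nlinarith)]; ring, pow_mul, pow_mul A, h1, pow_mul]
    simp
  have hcop : IsCoprime (X ^ 2 + 1) d := by
    refine IsCoprime.of_isCoprime_of_dvd_right ?_ hdg
    obtain ⟨b, hb⟩ := (isUnit_C.2 hS.isUnit).exists_left_inv
    refine ⟨b * (C A ^ 2 + (C α * X + C (α ^ q)) * (C A * X - C (A ^ q))),
      -b * (C A * X - C (A ^ q)), ?_⟩
    rw [gPoly_four]
    have e1 : C (α ^ q ^ 3) = C (A ^ q) + C (α ^ q) := by rw [← C_add, hB]; congr 1; ring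
    have e2 : C (α ^ q ^ 2) = C A + C α := by rw [← C_add, hA]; congr 1; ring
    rw [e1, e2]
    rw [C_add, C_pow, C_pow] at hb
    linear_combination hb
  have hd2 : d ∣ X ^ 2 - C 1 := by
    refine hcop.symm.dvd_of_dvd_mul_left ?_
    convert hd using 1
    rw [C_1]
    ring
  refine hα.not_dvd_gPoly_four hq2 hE (u := 1) (one_pow 2) (dvd_trans ?_ hdg)
  refine dvd_of_dvd_of_natDegree_eq (X_pow_sub_C_ne_zero two_pos 1) hd2 ?_
  rw [natDegree_X_pow_sub_C, hdeg]

/-- If there exists a primitive `2`-normal element in `F_{q^n}` over `F_q`, then `n ≥ 4`;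
moreover, if `n = 4` then `q ≡ 1 (mod 4)`. -/
theorem primitive_two_normal_necessary (q n : ℕ) (hq : IsPrimePow q) (hn : 0 < n)
    (E : Type*) [Field E] [Fintype E] (hE : Fintype.card E = q ^ n)
    (h : ∃ α : E, IsPrimitiveElem α ∧ IsKNormal q n 2 α) :
    4 ≤ n ∧ (n = 4 → q % 4 = 1) := by
  obtain ⟨α, hα, hk⟩ := h
  have hq2 := hq.two_le
  have h3 : 3 ≤ n := by
    obtain ⟨d, -, hdg, hdeg⟩ := hk.exists_dvd
    have h1 := natDegree_le_of_dvd hdg (gPoly_ne_zero hn hα.ne_zero)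
    have h2 := natDegree_gPoly_le q n α
    omega
  refine ⟨?_, ?_⟩
  · by_contra! hlt
    obtain rfl : n = 3 := by omega
    exact hα.not_isKNormal_three hq2 hE hk
  · rintro rfl
    by_contra hne
    rcases Nat.even_or_odd q with heven | hodd
    · exact hα.not_isKNormal_four_of_even hq2 heven.two_dvd hE hk
    · have hmod := Nat.odd_iff.1 hodd
      exact hα.not_isKNormal_four_of_mod_four_eq_three hq (by omega) hE hk

end
end

section
/- Let q be a prime power and n a positive integer with gcd(n, q) = 1. Let I_n(r) be the number of monic irreducible factors of x^n − 1 of degree r over F_q. Then I_n(r) = (1/r) · Σ_{d | r} t_d · μ(r/d), where t_d = gcd(q^d − 1, n) and μ is the Möbius function. -/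
open Polynomial

noncomputable section

/-- `In F n r` is the number of monic irreducible factors of `x^n - 1` of degree `r`
over the finite field `F`. -/
def In (F : Type*) [Field F] (n r : ℕ) : ℕ :=
  Nat.card {p : Polynomial F // p.Monic ∧ Irreducible p ∧ p.natDegree = r ∧
    p ∣ (X : Polynomial F) ^ n - 1}

open UniqueFactorizationMonoid in
/-- The finset of monic irreducible factors of a nonzero polynomial. -/
def monicIrredFactors {F : Type*} [Field F] (f : Polynomial F) : Finset (Polynomial F) := by
  classical exact (normalizedFactors f).toFinset

open UniqueFactorizationMonoid in
theorem mem_monicIrredFactors {F : Type*} [Field F] {f p : Polynomial F} (hf : f ≠ 0) :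
    p ∈ monicIrredFactors f ↔ p.Monic ∧ Irreducible p ∧ p ∣ f := by
  classical
  rw [monicIrredFactors, Multiset.mem_toFinset, Polynomial.mem_normalizedFactors_iff hf]
  tauto

open UniqueFactorizationMonoid in
theorem sum_natDegree_monicIrredFactors {F : Type*} [Field F] {f : Polynomial F}
    (hf : f ≠ 0) (hsq : Squarefree f) :
    ∑ p ∈ monicIrredFactors f, p.natDegree = f.natDegree := by
  classical
  have hnodup := (squarefree_iff_nodup_normalizedFactors hf).1 hsq
  have hdeg : (normalizedFactors f).prod.natDegree = f.natDegree :=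
    natDegree_eq_of_degree_eq (degree_eq_degree_of_associated (prod_normalizedFactors hf))
  rw [← hdeg, natDegree_multiset_prod _ (zero_notMem_normalizedFactors f), monicIrredFactors,
    Finset.sum, Multiset.toFinset_val, hnodup.dedup]

theorem dvd_X_pow_sub_one_iff {F : Type*} [Field F] (p : Polynomial F) (m : ℕ) :
    p ∣ (X : Polynomial F) ^ m - 1 ↔ AdjoinRoot.root p ^ m = 1 := by
  rw [← AdjoinRoot.mk_eq_zero, map_sub, map_pow, AdjoinRoot.mk_X, map_one, sub_eq_zero]

theorem dvd_X_pow_gcd_sub_one_iff {F : Type*} [Field F] (p : Polynomial F) (m n : ℕ) :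
    p ∣ (X : Polynomial F) ^ Nat.gcd m n - 1 ↔
      p ∣ (X : Polynomial F) ^ m - 1 ∧ p ∣ (X : Polynomial F) ^ n - 1 := by
  simp only [dvd_X_pow_sub_one_iff, ← orderOf_dvd_iff_pow_eq_one, Nat.dvd_gcd_iff]

/-- An irreducible divisor of `X ^ n - 1` with `n > 0` has degree dividing `r` iff it divides
`X ^ (q ^ r - 1) - 1`. -/
theorem natDegree_dvd_iff_dvd_X_pow_sub_one {F : Type*} [Field F] [Fintype F]
    {p : Polynomial F} (hp : Irreducible p) {n : ℕ} (hn : 0 < n)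
    (hpn : p ∣ (X : Polynomial F) ^ n - 1) (r : ℕ) :
    p.natDegree ∣ r ↔ p ∣ (X : Polynomial F) ^ (Fintype.card F ^ r - 1) - 1 := by
  have hX : ¬ p ∣ X := fun h ↦ hp.not_isUnit <| isUnit_of_dvd_one <| by
    simpa using dvd_sub (h.trans (dvd_pow_self X hn.ne')) hpn
  have hq : Fintype.card F ^ r - 1 + 1 = Fintype.card F ^ r :=
    Nat.sub_add_cancel (Nat.one_le_pow _ _ Fintype.card_pos)
  have hfac : (X : Polynomial F) ^ (Fintype.card F ^ r) - X =
      X * (X ^ (Fintype.card F ^ r - 1) - 1) := by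
    rw [mul_sub, mul_one, ← pow_succ', hq]
  rw [hp.natDegree_dvd_iff_dvd_X_pow_card_pow_sub_X, Nat.card_eq_fintype_card, hfac,
    hp.prime.dvd_mul]
  tauto

theorem In_eq_card_filter {F : Type*} [Field F] {n : ℕ} (hn : 0 < n) (d : ℕ) :
    In F n d =
      ((monicIrredFactors ((X : Polynomial F) ^ n - 1)).filter (·.natDegree = d)).card := by
  have hne : (X : Polynomial F) ^ n - 1 ≠ 0 := (monic_X_pow_sub_C (1 : F) hn.ne').ne_zero
  rw [In, Nat.subtype_card]
  intro p
  rw [Finset.mem_filter, mem_monicIrredFactors hne]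
  tauto

theorem sum_divisors_mul_In {F : Type*} [Field F] [Fintype F] {n : ℕ} (hn : 0 < n)
    (hgcd : Nat.Coprime n (Fintype.card F)) {r : ℕ} (hr : 0 < r) :
    ∑ d ∈ r.divisors, d * In F n d = Nat.gcd (Fintype.card F ^ r - 1) n := by
  set t := Nat.gcd (Fintype.card F ^ r - 1) n with ht
  have htpos : 0 < t := Nat.gcd_pos_of_pos_right _ hn
  have htF : (t : F) ≠ 0 := by
    intro h
    obtain ⟨c, hc⟩ := CharP.exists F
    have h1 : c ∣ t := (CharP.cast_eq_zero_iff F c t).1 h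
    have h2 : c ∣ Fintype.card F :=
      (CharP.cast_eq_zero_iff F c _).1 (FiniteField.cast_card_eq_zero F)
    exact CharP.char_ne_one F c
      (Nat.eq_one_of_dvd_coprimes hgcd (h1.trans (Nat.gcd_dvd_right _ _)) h2)
  have hne (m : ℕ) (hm : 0 < m) : (X : Polynomial F) ^ m - 1 ≠ 0 :=
    (monic_X_pow_sub_C (1 : F) hm.ne').ne_zero
  have hdeg : ((X : Polynomial F) ^ t - 1).natDegree = t := natDegree_X_pow_sub_C (r := (1 : F))
  have hsq : Squarefree ((X : Polynomial F) ^ t - 1) :=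
    (separable_X_pow_sub_C (1 : F) htF one_ne_zero).squarefree
  have hmem (p : Polynomial F) : p ∈ monicIrredFactors ((X : Polynomial F) ^ t - 1) ↔
      p ∈ monicIrredFactors ((X : Polynomial F) ^ n - 1) ∧ p.natDegree ∣ r := by
    rw [mem_monicIrredFactors (hne t htpos), mem_monicIrredFactors (hne n hn),
      dvd_X_pow_gcd_sub_one_iff]
    constructor
    · rintro ⟨hm, hi, h1, h2⟩
      exact ⟨⟨hm, hi, h2⟩, (natDegree_dvd_iff_dvd_X_pow_sub_one hi hn h2 r).2 h1⟩
    · rintro ⟨⟨hm, hi, h2⟩, h1⟩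
      exact ⟨hm, hi, (natDegree_dvd_iff_dvd_X_pow_sub_one hi hn h2 r).1 h1, h2⟩
  rw [← hdeg, ← sum_natDegree_monicIrredFactors (hne t htpos) hsq,
    ← Finset.sum_fiberwise_of_maps_to (t := r.divisors) (g := natDegree)
      fun p hp ↦ Nat.mem_divisors.2 ⟨((hmem p).1 hp).2, hr.ne'⟩]
  refine Finset.sum_congr rfl fun d hd ↦ ?_
  rw [In_eq_card_filter hn, Finset.sum_congr rfl fun p hp ↦ (Finset.mem_filter.1 hp).2,
    Finset.sum_const, smul_eq_mul, mul_comm]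
  congr 2
  ext p
  simp only [Finset.mem_filter, hmem]
  constructor
  · rintro ⟨h, rfl⟩
    exact ⟨⟨h, Nat.dvd_of_mem_divisors hd⟩, rfl⟩
  · tauto

/-- Let `q` be a prime power and `n` a positive integer with `gcd(n, q) = 1`.  Then the
number `I_n(r)` of monic irreducible factors of `x^n - 1` of degree `r` over `F_q`
satisfies `I_n(r) = (1/r) · Σ_{d ∣ r} t_d · μ(r/d)`, where `t_d = gcd(q^d - 1, n)`. -/
theorem In_eq_moebius_sum (q n : ℕ) (hq : IsPrimePow q) (hn : 0 < n)
    (hgcd : Nat.gcd n q = 1)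
    (F : Type*) [Field F] [Fintype F] (hF : Fintype.card F = q) (r : ℕ) :
    (In F n r : ℚ) =
      (1 / (r : ℚ)) * ∑ d ∈ r.divisors,
        (Nat.gcd (q ^ d - 1) n : ℚ) * (ArithmeticFunction.moebius (r / d) : ℚ) := by
  subst hF
  rcases Nat.eq_zero_or_pos r with rfl | hr
  · rw [In_eq_card_filter hn, Finset.card_eq_zero.2]
    · simp
    · refine Finset.filter_eq_empty_iff.2 fun p hp ↦ ?_
      have hne : (X : Polynomial F) ^ n - 1 ≠ 0 := (monic_X_pow_sub_C (1 : F) hn.ne').ne_zero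
      exact ((mem_monicIrredFactors hne).1 hp).2.1.natDegree_pos.ne'
  · have key := (ArithmeticFunction.sum_eq_iff_sum_mul_moebius_eq
      (f := fun d ↦ (d : ℚ) * In F n d)
      (g := fun d ↦ (Nat.gcd (Fintype.card F ^ d - 1) n : ℚ))).1
      (fun m hm ↦ by exact_mod_cast sum_divisors_mul_In hn hgcd hm) r hr
    rw [Nat.sum_divisorsAntidiagonal' (f := fun a b ↦
      (ArithmeticFunction.moebius a : ℚ) * (Nat.gcd (Fintype.card F ^ b - 1) n : ℚ))] at key
    have hr0 : (r : ℚ) ≠ 0 := Nat.cast_ne_zero.2 hr.ne'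
    simp_rw [mul_comm (Nat.cast (R := ℚ) (Nat.gcd _ n))]
    rw [key]
    field_simp

end
end

section
/- Let f, T ∈ F_q[x] be monic divisors of x^n − 1 with deg f = k and gcd((x^n − 1)/f, T) ≠ 1, and let m be a positive divisor of q^n − 1. If q^{n/2 − k} ≥ W(m) · W(T), then N_f(T, m) > 0. -/
open Polynomial

noncomputable section

/-- The linearized `q`-associate of `f = Σ a_i x^i ∈ F_q[x]`, evaluated at `α ∈ F_{q^n}`:
`L_f(α) = Σ a_i α^{q^i}`. -/
def Lf {F E : Type*} [Field F] [Field E] [Algebra F E] (q : ℕ) (f : Polynomial F) (α : E) : E :=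
  ∑ i ∈ Finset.range (f.natDegree + 1), algebraMap F E (f.coeff i) * α ^ q ^ i

/-- For `m ∣ q^n - 1`, an element `α ∈ F_{q^n}*` is `m`-free if whenever `α = β^d` for some
`β ∈ F_{q^n}` and some divisor `d` of `m`, then `d = 1`. -/
def IsFree {E : Type*} [Field E] (m : ℕ) (α : E) : Prop :=
  α ≠ 0 ∧ ∀ d : ℕ, d ∣ m → (∃ β : E, α = β ^ d) → d = 1

/-- For a monic divisor `T` of `x^n - 1` in `F_q[x]`, an element `α ∈ F_{q^n}` is `T`-free
if whenever `α = L_h(β)` for some `β ∈ F_{q^n}` and some monic divisor `h` of `T`,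
then `h = 1`. -/
def IsPolyFree {F E : Type*} [Field F] [Field E] [Algebra F E] (q : ℕ) (T : Polynomial F)
    (α : E) : Prop :=
  ∀ h : Polynomial F, h.Monic → h ∣ T → (∃ β : E, Lf q h β = α) → h = 1

/-- `Nf q F E f T m` is the number of `T`-free elements `α ∈ F_{q^n}` such that `L_f(α)` is
`m`-free. -/
def Nf (q : ℕ) (F E : Type*) [Field F] [Field E] [Algebra F E]
    (f T : Polynomial F) (m : ℕ) : ℕ :=
  Nat.card {α : E // IsPolyFree q T α ∧ IsFree m (Lf q f α)}

/-- `Wnat m` is the number of squarefree divisors of the integer `m`. -/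
def Wnat (m : ℕ) : ℕ := Nat.card {d : ℕ // d ∣ m ∧ Squarefree d}

/-- `Wpoly T` is the number of squarefree monic divisors of the polynomial `T`. -/
def Wpoly {F : Type*} [Field F] (T : Polynomial F) : ℕ :=
  Nat.card {h : Polynomial F // h.Monic ∧ Squarefree h ∧ h ∣ T}

/-- `radNat m` is the largest squarefree divisor of the positive integer `m`. -/
def radNat (m : ℕ) : ℕ := ∏ p ∈ m.primeFactors, p

/-- `radPoly T` is the monic squarefree radical of the polynomial `T` : the product of its
distinct monic irreducible factors. -/
def radPoly {F : Type*} [Field F] (T : Polynomial F) : Polynomial F :=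
  letI := Classical.decEq F
  ∏ p ∈ (UniqueFactorizationMonoid.normalizedFactors T).toFinset, p

theorem MulChar.prod_apply_of_ne_zero {E ι : Type*} [Field E] (s : Finset ι) (χ : ι → MulChar E ℂ) {y : E}
    (hy : y ≠ 0) : (∏ i ∈ s, χ i) y = ∏ i ∈ s, χ i y := by
  classical
  induction s using Finset.induction_on with
  | empty => simp [MulChar.one_apply hy.isUnit]
  | insert i s hi ih => rw [Finset.prod_insert hi, Finset.prod_insert hi, MulChar.mul_apply, ih]

theorem Finset.prod_one_sub_eq_sum_powerset {ι R : Type*} [CommRing R] (s : Finset ι) (g : ι → R) :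
    ∏ i ∈ s, (1 - g i) = ∑ t ∈ s.powerset, (-1) ^ t.card * ∏ i ∈ t, g i := by
  simp_rw [sub_eq_add_neg, Finset.prod_one_add, Finset.prod_neg]

section CharacterSums

variable {E : Type*} [Field E] [Fintype E]

theorem norm_gaussSum_le {χ : MulChar E ℂ} (hχ : χ ≠ 1) (η : AddChar E ℂ) :
    ‖gaussSum χ η‖ ≤ √(Fintype.card E) := by
  by_cases hη : η = 1
  · simp [hη, gaussSum_one_right hχ]
  · apply Real.le_sqrt_of_sq_le
    have h := gaussSum_mul_gaussSum_eq_card hχ (AddChar.IsPrimitive.of_ne_one hη)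
    rw [← star_gaussSum_eq, RCLike.star_def, Complex.mul_conj'] at h
    have h' : ‖gaussSum χ η‖ ^ 2 = Fintype.card E := by exact_mod_cast h
    exact h'.le

/-- Fourier inversion for a multiplicative character on the additive group of the field. -/
theorem card_mul_mulChar_eq_sum (χ : MulChar E ℂ) (y : E) :
    (Fintype.card E : ℂ) * χ y = ∑ η : AddChar E ℂ, gaussSum χ η⁻¹ * η y := by
  classical
  simp_rw [gaussSum, Finset.sum_mul]
  rw [Finset.sum_comm]
  have h (z : E) : ∑ η : AddChar E ℂ, χ z * η⁻¹ z * η y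
      = if z = y then χ z * Fintype.card E else 0 := by
    have h1 (η : AddChar E ℂ) : χ z * η⁻¹ z * η y = χ z * η (y - z) := by
      rw [mul_assoc, AddChar.inv_apply, ← AddChar.map_add_eq_mul, neg_add_eq_sub]
    simp_rw [h1, ← Finset.mul_sum, AddChar.sum_apply_eq_ite, sub_eq_zero, eq_comm (a := y)]
    simp
  simp_rw [h]
  simp [mul_comm]

theorem sum_norm_sum_addChar_mul_comp_le (ψ : AddChar E ℂ) (L : E →+ E) :
    ∑ η : AddChar E ℂ, ‖∑ α, ψ α * η (L α)‖ ≤ Fintype.card E * Nat.card L.ker := by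
  classical
  have hnn (η : AddChar E ℂ) : ((‖∑ α, ψ α * η (L α)‖ : ℝ) : ℂ) = ∑ α, ψ α * η (L α) := by
    have h := AddChar.sum_eq_ite (ψ * η.compAddMonoidHom L)
    simp only [AddChar.mul_apply, AddChar.compAddMonoidHom_apply] at h
    rw [h]
    split_ifs <;> simp
  have hsum : ∑ η : AddChar E ℂ, ∑ α, ψ α * η (L α)
      = Fintype.card E * ∑ α with L α = 0, ψ α := by
    rw [Finset.sum_comm]
    simp_rw [← Finset.mul_sum, AddChar.sum_apply_eq_ite, Finset.sum_filter, Finset.mul_sum]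
    exact Finset.sum_congr rfl fun α _ ↦ by split_ifs <;> simp [mul_comm]
  have hcast : ((∑ η : AddChar E ℂ, ‖∑ α, ψ α * η (L α)‖ : ℝ) : ℂ)
      = Fintype.card E * ∑ α with L α = 0, ψ α := by
    push_cast
    simp_rw [hnn]
    exact hsum
  have hcard : ((Finset.univ.filter fun α ↦ L α = 0).card : ℝ) = Nat.card L.ker := by
    rw [Nat.card_eq_fintype_card, Fintype.card_subtype]
    simp [AddMonoidHom.mem_ker]
  have hnn' : 0 ≤ ∑ η : AddChar E ℂ, ‖∑ α, ψ α * η (L α)‖ := by positivity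
  calc _ = ‖((∑ η : AddChar E ℂ, ‖∑ α, ψ α * η (L α)‖ : ℝ) : ℂ)‖ := by
        rw [Complex.norm_real, Real.norm_of_nonneg hnn']
    _ = Fintype.card E * ‖∑ α with L α = 0, ψ α‖ := by rw [hcast]; simp
    _ ≤ Fintype.card E * Nat.card L.ker := by
        gcongr
        refine (norm_sum_le _ _).trans ?_
        simp [AddChar.norm_apply, hcard]

theorem norm_sum_addChar_mul_mulChar_comp_le (ψ : AddChar E ℂ) {χ : MulChar E ℂ} (hχ : χ ≠ 1)
    (L : E →+ E) :
    ‖∑ α, ψ α * χ (L α)‖ ≤ √(Fintype.card E) * Nat.card L.ker := by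
  have hpos : (0 : ℝ) < Fintype.card E := by exact_mod_cast Fintype.card_pos
  have key : (Fintype.card E : ℂ) * ∑ α, ψ α * χ (L α)
      = ∑ η : AddChar E ℂ, gaussSum χ η⁻¹ * ∑ α, ψ α * η (L α) := by
    simp_rw [Finset.mul_sum]
    rw [Finset.sum_comm]
    refine Finset.sum_congr rfl fun α _ ↦ ?_
    rw [mul_left_comm, card_mul_mulChar_eq_sum, Finset.mul_sum]
    exact Finset.sum_congr rfl fun η _ ↦ by ring
  refine le_of_mul_le_mul_left ?_ hpos
  calc _ = ‖(Fintype.card E : ℂ) * ∑ α, ψ α * χ (L α)‖ := by simp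
    _ ≤ ∑ η : AddChar E ℂ, √(Fintype.card E) * ‖∑ α, ψ α * η (L α)‖ := by
        rw [key]
        refine (norm_sum_le _ _).trans (Finset.sum_le_sum fun η _ ↦ ?_)
        rw [norm_mul]
        gcongr
        exact norm_gaussSum_le hχ _
    _ ≤ √(Fintype.card E) * (Fintype.card E * Nat.card L.ker) := by
        rw [← Finset.mul_sum]
        gcongr
        exact sum_norm_sum_addChar_mul_comp_le ψ L
    _ = _ := by ring

/-- A proper subgroup is annihilated by a nontrivial character. -/
theorem exists_addChar_ne_one_of_ne_top {V : AddSubgroup E} (hV : V ≠ ⊤) :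
    ∃ ψ : AddChar E ℂ, ψ ≠ 1 ∧ ∀ x ∈ V, ψ x = 1 := by
  obtain ⟨a, -, ha⟩ := SetLike.exists_of_lt hV.lt_top
  have ha' : (QuotientAddGroup.mk' V a) ≠ 0 := by simpa using ha
  obtain ⟨ψ, hψ⟩ := AddChar.exists_apply_ne_zero.2 ha'
  refine ⟨ψ.compAddMonoidHom (QuotientAddGroup.mk' V), fun h ↦ hψ ?_, fun x hx ↦ ?_⟩
  · simpa using DFunLike.congr_fun h a
  · have : QuotientAddGroup.mk' V x = 0 := by simpa using hx
    rw [AddChar.compAddMonoidHom_apply, this, AddChar.map_zero_eq_one]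

/-- The main estimate of the sieve: a product of `1 - ψ` and `1 - χ` over independent characters
has nonzero sum once the field is large. -/
theorem exists_prod_one_sub_ne_zero {ι κ : Type*} (s : Finset ι) (t : Finset κ)
    (ψ : ι → AddChar E ℂ) (χ : κ → MulChar E ℂ) (L : E →+ E)
    (hψ : ∀ S ⊆ s, S.Nonempty → ∏ i ∈ S, ψ i ≠ 1)
    (hχ : ∀ S ⊆ t, S.Nonempty → ∏ i ∈ S, χ i ≠ 1)
    (hker : ∀ α, L α = 0 → ∃ i ∈ s, ψ i α = 1)
    (hbound : (2 : ℝ) ^ t.card * 2 ^ s.card * Nat.card L.ker ≤ √(Fintype.card E)) :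
    ∃ α, L α ≠ 0 ∧ (∀ i ∈ s, ψ i α ≠ 1) ∧ ∀ j ∈ t, χ j (L α) ≠ 1 := by
  classical
  by_contra! hcon
  set Q : ℝ := (Fintype.card E : ℝ) with hQ
  have hQpos : 0 < Q := by rw [hQ]; exact_mod_cast Fintype.card_pos
  set K : ℝ := (Nat.card L.ker : ℝ) with hK
  have hKpos : 0 < K := by rw [hK]; exact_mod_cast Nat.card_pos
  set A : E → ℂ := fun α ↦ ∏ i ∈ s, (1 - ψ i α) with hA
  have hAexp (α : E) : A α = ∑ S ∈ s.powerset, (-1) ^ S.card * (∏ i ∈ S, ψ i) α := by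
    simp only [hA, Finset.prod_one_sub_eq_sum_powerset, AddChar.prod_apply]
  have hzero : ∑ S ∈ t.powerset, ∑ α, (-1) ^ S.card * (A α * (∏ j ∈ S, χ j) (L α)) = 0 := by
    rw [Finset.sum_comm]
    refine Finset.sum_eq_zero fun α _ ↦ ?_
    by_cases h0 : L α = 0
    · refine Finset.sum_eq_zero fun S _ ↦ ?_
      rw [h0, MulChar.map_zero]
      ring
    · by_cases h1 : ∀ i ∈ s, ψ i α ≠ 1
      · obtain ⟨j, hj, hj1⟩ := hcon α h0 h1
        have : ∏ j ∈ t, (1 - χ j (L α)) = 0 := Finset.prod_eq_zero hj (by simp [hj1])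
        rw [Finset.prod_one_sub_eq_sum_powerset] at this
        simp_rw [MulChar.prod_apply_of_ne_zero _ _ h0, mul_left_comm _ (A α), ← Finset.mul_sum,
          this, mul_zero]
      · push Not at h1
        obtain ⟨i, hi, hi1⟩ := h1
        have : A α = 0 := Finset.prod_eq_zero hi (by simp [hi1])
        simp [this]
  have hmain : ∑ α, A α * (1 : MulChar E ℂ) (L α) = Q := by
    have h1 (α : E) : A α * (1 : MulChar E ℂ) (L α) = A α := by
      by_cases h0 : L α = 0
      · obtain ⟨i, hi, hi1⟩ := hker α h0
        have : A α = 0 := Finset.prod_eq_zero hi (by simp [hi1])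
        simp [this]
      · rw [MulChar.one_apply (Ne.isUnit h0), mul_one]
    simp_rw [h1, hAexp]
    rw [Finset.sum_comm, Finset.sum_eq_single_of_mem ∅ (Finset.empty_mem_powerset s)]
    · simp [hQ]
    · intro S hS hne
      rw [← Finset.mul_sum, AddChar.sum_eq_zero_of_ne_one, mul_zero]
      exact hψ S (Finset.mem_powerset.1 hS) (Finset.nonempty_iff_ne_empty.2 hne)
  have herr (S : Finset κ) (hS : S ∈ t.powerset.erase ∅) :
      ‖∑ α, (-1) ^ S.card * (A α * (∏ j ∈ S, χ j) (L α))‖ ≤ 2 ^ s.card * (√Q * K) := by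
    rw [Finset.mem_erase, Finset.mem_powerset] at hS
    have hχS := hχ S hS.2 (Finset.nonempty_iff_ne_empty.2 hS.1)
    rw [← Finset.mul_sum, norm_mul, norm_pow, norm_neg, norm_one, one_pow, one_mul]
    simp_rw [hAexp, Finset.sum_mul]
    rw [Finset.sum_comm]
    refine (norm_sum_le _ _).trans ?_
    refine (Finset.sum_le_card_nsmul _ _ (√Q * K) fun U _ ↦ ?_).trans ?_
    · simp_rw [mul_assoc, ← Finset.mul_sum]
      rw [norm_mul, norm_pow, norm_neg, norm_one, one_pow, one_mul]
      exact norm_sum_addChar_mul_mulChar_comp_le _ hχS L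
    · simp [Finset.card_powerset]
  rw [← Finset.add_sum_erase _ _ (Finset.empty_mem_powerset t)] at hzero
  simp only [Finset.card_empty, pow_zero, one_mul, Finset.prod_empty, hmain] at hzero
  have hle : Q ≤ (2 ^ t.card - 1) * (2 ^ s.card * (√Q * K)) := by
    calc Q = ‖(Q : ℂ)‖ := by simp [abs_of_pos hQpos]
      _ = ‖∑ S ∈ t.powerset.erase ∅, ∑ α, (-1) ^ S.card * (A α * (∏ j ∈ S, χ j) (L α))‖ := by
          rw [eq_neg_of_add_eq_zero_left hzero, norm_neg]
      _ ≤ (t.powerset.erase ∅).card • (2 ^ s.card * (√Q * K)) :=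
          (norm_sum_le _ _).trans (Finset.sum_le_card_nsmul _ _ _ herr)
      _ = _ := by
          rw [Finset.card_erase_of_mem (Finset.empty_mem_powerset t), Finset.card_powerset,
            nsmul_eq_mul, Nat.cast_sub Nat.one_le_two_pow]
          simp
  have hsq : 0 < √Q := Real.sqrt_pos.2 hQpos
  have hpos : 0 < 2 ^ s.card * (√Q * K) := by positivity
  have := mul_le_mul_of_nonneg_right hbound hsq.le
  rw [Real.mul_self_sqrt hQpos.le] at this
  nlinarith

end CharacterSums

section Linearized

variable (F E : Type*) [Field F] [Fintype F] [Field E] [Algebra F E]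

/-- The `q`-Frobenius of `E` as an `F`-linear map; `L_f` is `f` evaluated at it. -/
def frobEnd : Module.End F E := (FiniteField.frobeniusAlgHom F E).toLinearMap

variable {F E}

theorem frobEnd_pow_apply (i : ℕ) (α : E) :
    (frobEnd F E ^ i) α = α ^ Fintype.card F ^ i := by
  induction i generalizing α with
  | zero => simp
  | succ i ih =>
    rw [pow_succ, Module.End.mul_apply, ih, pow_succ', pow_mul]
    rfl

theorem Lf_eq_aeval (f : F[X]) (α : E) :
    Lf (Fintype.card F) f α = aeval (frobEnd F E) f α := by
  simp [Lf, aeval_eq_sum_range, frobEnd_pow_apply, Algebra.smul_def]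

variable [Fintype E]

theorem aeval_frobEnd_X_pow_sub_one :
    aeval (frobEnd F E) ((X : F[X]) ^ Module.finrank F E - 1) = 0 := by
  rw [← FiniteField.minpoly_frobeniusAlgHom F E]
  exact minpoly.aeval _ _

theorem finrank_ker_aeval_frobEnd_le {f : F[X]} (hf : f.Monic) :
    Module.finrank F (LinearMap.ker (aeval (frobEnd F E) f)) ≤ f.natDegree := by
  classical
  set q := Fintype.card F with hq
  have hq1 : 1 < q := Fintype.one_lt_card
  set p : E[X] := ∑ i ∈ Finset.range (f.natDegree + 1),
    C (algebraMap F E (f.coeff i)) * X ^ q ^ i with hp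
  have hp0 : p ≠ 0 := by
    intro h
    have h1 : p.coeff (q ^ f.natDegree) = 1 := by
      simp only [hp, finsetSum_coeff, coeff_C_mul, coeff_X_pow]
      rw [Finset.sum_eq_single_of_mem f.natDegree (by simp)]
      · simp [hf.coeff_natDegree]
      · intro i _ hi
        rw [if_neg fun h ↦ hi (Nat.pow_right_injective hq1 h).symm, mul_zero]
    simp [h] at h1
  have hdeg : p.natDegree ≤ q ^ f.natDegree := by
    refine natDegree_sum_le_of_forall_le _ _ fun i hi ↦ (natDegree_C_mul_X_pow_le _ _).trans ?_
    exact Nat.pow_le_pow_right (by lia) (Nat.lt_succ_iff.1 (Finset.mem_range.1 hi))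
  have hmem (α : LinearMap.ker (aeval (frobEnd F E) f)) : (α : E) ∈ p.roots.toFinset := by
    have h := α.2
    rw [LinearMap.mem_ker, ← Lf_eq_aeval] at h
    rw [Multiset.mem_toFinset, mem_roots hp0, IsRoot, hp, eval_finsetSum]
    simpa [Lf] using h
  have hcard : Fintype.card (LinearMap.ker (aeval (frobEnd F E) f)) ≤ p.roots.toFinset.card := by
    rw [← Fintype.card_coe]
    exact Fintype.card_le_of_injective (fun α ↦ ⟨α, hmem α⟩) fun a b h ↦ by
      simpa using h
  rw [Module.card_eq_pow_finrank (K := F)] at hcard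
  exact (Nat.pow_le_pow_iff_right hq1).1
    (hcard.trans ((Multiset.toFinset_card_le _).trans ((card_roots' p).trans hdeg)))

theorem range_aeval_frobEnd_ne_top {P : F[X]} (hP : P.Monic) (hPd : 0 < P.natDegree)
    (hdvd : P ∣ X ^ Module.finrank F E - 1) :
    LinearMap.range (aeval (frobEnd F E) P) ≠ ⊤ := by
  intro htop
  obtain ⟨R, hR⟩ := hdvd
  have hn : Module.finrank F E ≠ 0 := Module.finrank_pos.ne'
  have hmon := monic_X_pow_sub_C (1 : F) hn
  rw [C_1, hR] at hmon
  have hRm : R.Monic := hP.of_mul_monic_left hmon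
  have hdeg : P.natDegree + R.natDegree = Module.finrank F E := by
    rw [← hP.natDegree_mul hRm, ← hR, ← C_1, natDegree_X_pow_sub_C]
  have hker : LinearMap.ker (aeval (frobEnd F E) R) = ⊤ := by
    rw [LinearMap.ker_eq_top]
    ext α
    obtain ⟨β, rfl⟩ := LinearMap.range_eq_top.1 htop α
    rw [← Module.End.mul_apply, ← map_mul, mul_comm, ← hR, aeval_frobEnd_X_pow_sub_one]
    simp
  have := finrank_ker_aeval_frobEnd_le (E := E) hRm
  rw [hker, finrank_top] at this
  lia

theorem ker_aeval_frobEnd_le_range {f g : F[X]} (hf : f.Monic)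
    (hfg : f * g = X ^ Module.finrank F E - 1) :
    LinearMap.ker (aeval (frobEnd F E) f) ≤ LinearMap.range (aeval (frobEnd F E) g) := by
  have hn : Module.finrank F E ≠ 0 := Module.finrank_pos.ne'
  have hmon := monic_X_pow_sub_C (1 : F) hn
  rw [C_1, ← hfg] at hmon
  have hgm : g.Monic := hf.of_mul_monic_left hmon
  have hdeg : f.natDegree + g.natDegree = Module.finrank F E := by
    rw [← hf.natDegree_mul hgm, hfg, ← C_1, natDegree_X_pow_sub_C]
  refine (Submodule.eq_of_le_of_finrank_le ?_ ?_).ge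
  · rintro _ ⟨β, rfl⟩
    rw [LinearMap.mem_ker, ← Module.End.mul_apply, ← map_mul, hfg, aeval_frobEnd_X_pow_sub_one]
    simp
  · have h1 := finrank_ker_aeval_frobEnd_le (E := E) hf
    have h2 := finrank_ker_aeval_frobEnd_le (E := E) hgm
    have h3 := LinearMap.finrank_range_add_finrank_ker (aeval (frobEnd F E) g)
    lia

/-- Characters annihilating the images of pairwise coprime `L_P` are independent. -/
theorem prod_addChar_ne_one {S : Finset F[X]} (hS : S.Nonempty) {ψ : F[X] → AddChar E ℂ}
    (hcop : (S : Set F[X]).Pairwise IsCoprime)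
    (hψ : ∀ P ∈ S, ψ P ≠ 1 ∧ ∀ β, ψ P (aeval (frobEnd F E) P β) = 1) :
    ∏ P ∈ S, ψ P ≠ 1 := by
  classical
  intro hprod
  obtain ⟨P, hP⟩ := hS
  refine (hψ P hP).1 ?_
  obtain ⟨u, v, huv⟩ : IsCoprime P (∏ R ∈ S.erase P, R) :=
    IsCoprime.prod_right fun R hR ↦ hcop hP (Finset.mem_of_mem_erase hR)
      (Finset.ne_of_mem_erase hR).symm
  set Q := ∏ R ∈ S.erase P, R with hQ
  have hPQ (β : E) : ψ P (aeval (frobEnd F E) Q β) = 1 := by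
    have h := DFunLike.congr_fun hprod (aeval (frobEnd F E) Q β)
    rw [AddChar.prod_apply, ← Finset.mul_prod_erase _ _ hP, AddChar.one_apply,
      Finset.prod_eq_one, mul_one] at h
    · exact h
    · intro R hR
      rw [hQ, ← Finset.mul_prod_erase _ _ hR, map_mul, Module.End.mul_apply]
      exact (hψ R (Finset.mem_of_mem_erase hR)).2 _
  ext β
  have hβ : β = aeval (frobEnd F E) P (aeval (frobEnd F E) u β)
      + aeval (frobEnd F E) Q (aeval (frobEnd F E) v β) := by
    rw [← Module.End.mul_apply, ← Module.End.mul_apply, ← map_mul, ← map_mul,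
      ← LinearMap.add_apply, ← map_add, mul_comm P, mul_comm Q, huv]
    simp
  rw [hβ, AddChar.map_add_eq_mul, (hψ P hP).2, hPQ]
  simp

end Linearized

theorem prod_mulChar_ne_one {E : Type*} [Field E] {S : Finset ℕ} (hS : S.Nonempty)
    {χ : ℕ → MulChar E ℂ} (hp : ∀ p ∈ S, p.Prime) (hχ : ∀ p ∈ S, orderOf (χ p) = p) :
    ∏ p ∈ S, χ p ≠ 1 := by
  classical
  intro hprod
  obtain ⟨p, hpS⟩ := hS
  have hothers : (∏ r ∈ S.erase p, χ r) ^ (∏ r ∈ S.erase p, r) = 1 := by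
    rw [← Finset.prod_pow]
    refine Finset.prod_eq_one fun r hr ↦ ?_
    rw [← orderOf_dvd_iff_pow_eq_one, hχ r (Finset.mem_of_mem_erase hr)]
    exact Finset.dvd_prod_of_mem _ hr
  have hpow := congrArg (· ^ (∏ r ∈ S.erase p, r)) hprod
  simp only [← Finset.mul_prod_erase _ _ hpS, mul_pow, hothers, mul_one, one_pow] at hpow
  rw [← orderOf_dvd_iff_pow_eq_one, hχ p hpS, (hp p hpS).prime.dvd_finsetProd_iff] at hpow
  obtain ⟨r, hr, hdvd⟩ := hpow
  rw [Finset.mem_erase] at hr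
  exact hr.1 ((Nat.prime_dvd_prime_iff_eq (hp p hpS) (hp r hr.2)).1 hdvd).symm

theorem two_pow_card_primeFactors_le_Wnat {m : ℕ} (hm : m ≠ 0) :
    2 ^ m.primeFactors.card ≤ Wnat m := by
  have h := Nat.sum_divisors_filter_squarefree hm (f := fun _ ↦ 1)
  rw [Finset.sum_const, Finset.sum_const, Finset.card_powerset, smul_eq_mul, smul_eq_mul, mul_one,
    mul_one] at h
  have hfac : (UniqueFactorizationMonoid.normalizedFactors m).toFinset = m.primeFactors := by
    rw [Nat.factors_eq]
    rfl
  rw [← hfac, ← h, Wnat, ← Nat.card_eq_finsetCard]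
  refine (Nat.card_congr (Equiv.subtypeEquivRight fun d ↦ ?_)).le
  simp [hm]

/-- The monic irreducible factors of a polynomial. -/
def monicFactors {F : Type*} [Field F] (T : F[X]) : Finset F[X] :=
  letI := Classical.decEq F
  (UniqueFactorizationMonoid.normalizedFactors T).toFinset

theorem mem_monicFactors {F : Type*} [Field F] {T P : F[X]} (hT : T ≠ 0) :
    P ∈ monicFactors T ↔ Irreducible P ∧ P.Monic ∧ P ∣ T := by
  classical
  rw [monicFactors, Multiset.mem_toFinset, Polynomial.mem_normalizedFactors_iff hT]

theorem pairwise_isCoprime_monicFactors {F : Type*} [Field F] {T : F[X]} (hT : T ≠ 0) :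
    (monicFactors T : Set F[X]).Pairwise IsCoprime := by
  intro P hP R hR hne
  rw [Finset.mem_coe, mem_monicFactors hT] at hP hR
  rw [hP.1.coprime_iff_not_dvd]
  exact fun h ↦ hne (eq_of_monic_of_associated hP.2.1 hR.2.1 (hP.1.associated_of_dvd hR.1 h))

theorem exists_mem_monicFactors_dvd {F : Type*} [Field F] {T h : F[X]} (hT : T ≠ 0) (hh : h ∣ T)
    (hu : ¬ IsUnit h) : ∃ P ∈ monicFactors T, P ∣ h := by
  classical
  have h0 : h ≠ 0 := ne_zero_of_dvd_ne_zero hT hh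
  obtain ⟨P, hP, hPh⟩ := WfDvdMonoid.exists_irreducible_factor hu h0
  have ha : Associated (normalize P) P := normalize_associated P
  have hdvd : normalize P ∣ h := ha.dvd.trans hPh
  exact ⟨normalize P, (mem_monicFactors hT).2
    ⟨ha.irreducible_iff.2 hP, monic_normalize hP.ne_zero, hdvd.trans hh⟩, hdvd⟩

theorem two_pow_card_monicFactors_le_Wpoly {F : Type*} [Field F] {T : F[X]} (hT : T ≠ 0) :
    2 ^ (monicFactors T).card ≤ Wpoly T := by
  classical
  have : Fintype {g : F[X] // g.Monic ∧ g ∣ T} := fintypeSubtypeMonicDvd T hT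
  have : Finite {h : F[X] // h.Monic ∧ Squarefree h ∧ h ∣ T} :=
    Finite.of_injective
      (fun h ↦ (⟨h.1, h.2.1, h.2.2.2⟩ : {g : F[X] // g.Monic ∧ g ∣ T}))
      fun a b h ↦ Subtype.ext (Subtype.mk.inj h)
  have hmem {S : Finset F[X]} (hS : S ∈ (monicFactors T).powerset) {P : F[X]} (hP : P ∈ S) :
      Irreducible P ∧ P.Monic ∧ P ∣ T :=
    (mem_monicFactors hT).1 (Finset.mem_powerset.1 hS hP)
  have hpair {S : Finset F[X]} (hS : S ∈ (monicFactors T).powerset) :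
      (S : Set F[X]).Pairwise IsCoprime :=
    (pairwise_isCoprime_monicFactors hT).mono
      (Finset.coe_subset.2 (Finset.mem_powerset.1 hS))
  rw [← Finset.card_powerset, ← Nat.card_eq_finsetCard, Wpoly]
  refine Nat.card_le_card_of_injective (fun S ↦ ⟨∏ P ∈ S.1, P,
    monic_prod_of_monic _ _ fun P hP ↦ (hmem S.2 hP).2.1, ?_, ?_⟩) ?_
  · refine Finset.squarefree_prod_of_pairwise_isCoprime
      (fun P hP R hR hne ↦ (hpair S.2 hP hR hne).isRelPrime)
      fun P hP ↦ (hmem S.2 hP).1.squarefree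
  · exact Finset.prod_dvd_of_coprime (hpair S.2) fun P hP ↦ (hmem S.2 hP).2.2
  · have hsub {S U : Finset F[X]} (hS : S ∈ (monicFactors T).powerset)
        (hU : U ∈ (monicFactors T).powerset) (h : ∏ P ∈ S, P = ∏ P ∈ U, P) : S ⊆ U := by
      intro P hP
      have hd : P ∣ ∏ R ∈ U, R := h ▸ Finset.dvd_prod_of_mem _ hP
      obtain ⟨R, hR, hPR⟩ := ((hmem hS hP).1.prime.dvd_finsetProd_iff _).1 hd
      rwa [eq_of_monic_of_associated (hmem hS hP).2.1 (hmem hU hR).2.1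
        ((hmem hS hP).1.associated_of_dvd (hmem hU hR).1 hPR)]
    intro S U h
    have h' : ∏ P ∈ S.1, P = ∏ P ∈ U.1, P := congrArg Subtype.val h
    exact Subtype.ext ((hsub S.2 U.2 h').antisymm (hsub U.2 S.2 h'.symm))

/-- Let `f, T ∈ F_q[x]` be monic divisors of `x^n - 1` with `deg f = k` and
`gcd((x^n - 1)/f, T) ≠ 1`, and let `m` be a positive divisor of `q^n - 1`.
If `q^{n/2 - k} ≥ W(m) · W(T)` then `N_f(T, m) > 0`. -/
theorem Nf_pos_of_bound (q n k : ℕ) (hn : 0 < n)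
    (F E : Type*) [Field F] [Fintype F] [Field E] [Fintype E] [Algebra F E]
    (hF : Fintype.card F = q) (hE : Fintype.card E = q ^ n)
    (f T : Polynomial F) (hfm : f.Monic) (hTm : T.Monic)
    (hfd : f ∣ (X : Polynomial F) ^ n - 1) (hTd : T ∣ (X : Polynomial F) ^ n - 1)
    (hk : f.natDegree = k)
    (hncop : ¬ IsCoprime (((X : Polynomial F) ^ n - 1) / f) T)
    (m : ℕ) (hm : 0 < m) (hmd : m ∣ q ^ n - 1)
    (hbound : (Wnat m : ℝ) * (Wpoly T : ℝ) ≤ (q : ℝ) ^ ((n : ℝ) / 2 - (k : ℝ))) :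
    0 < Nf q F E f T m := by
  classical
  subst hF
  have hfin : Module.finrank F E = n := by
    rw [Module.card_eq_pow_finrank (K := F)] at hE
    exact Nat.pow_right_injective (Fintype.one_lt_card (α := F)) hE
  subst hfin
  have hT0 := hTm.ne_zero
  have hψ_exists (P : F[X]) : ∃ ψ : AddChar E ℂ, P ∈ monicFactors T →
      ψ ≠ 1 ∧ ∀ β, ψ (aeval (frobEnd F E) P β) = 1 := by
    by_cases hP : P ∈ monicFactors T
    · obtain ⟨hPi, hPm, hPT⟩ := (mem_monicFactors hT0).1 hP
      have hne := range_aeval_frobEnd_ne_top (E := E) hPm hPi.natDegree_pos (hPT.trans hTd)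
      obtain ⟨ψ, h1, h2⟩ := exists_addChar_ne_one_of_ne_top
        (V := (LinearMap.range (aeval (frobEnd F E) P)).toAddSubgroup) (by simpa using hne)
      exact ⟨ψ, fun _ ↦ ⟨h1, fun β ↦ h2 _ ⟨β, rfl⟩⟩⟩
    · exact ⟨1, fun h ↦ absurd h hP⟩
  choose ψ hψ using hψ_exists
  have hχ_exists (p : ℕ) : ∃ χ : MulChar E ℂ, p ∈ m.primeFactors → orderOf χ = p := by
    by_cases hp : p ∈ m.primeFactors
    · rw [← hE] at hmd
      obtain ⟨χ, hχ⟩ := MulChar.exists_mulChar_orderOf E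
        ((Nat.dvd_of_mem_primeFactors hp).trans hmd)
        (Complex.isPrimitiveRoot_exp p (Nat.prime_of_mem_primeFactors hp).ne_zero)
      exact ⟨χ, fun _ ↦ hχ⟩
    · exact ⟨1, fun h ↦ absurd h hp⟩
  choose χ hχ using hχ_exists
  have hcardker : Nat.card (aeval (frobEnd F E) f).toAddMonoidHom.ker ≤ Fintype.card F ^ k := by
    have h1 : Nat.card (aeval (frobEnd F E) f).toAddMonoidHom.ker
        = Nat.card (LinearMap.ker (aeval (frobEnd F E) f)) := rfl
    rw [h1, Module.natCard_eq_pow_finrank (K := F), Nat.card_eq_fintype_card, ← hk]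
    exact Nat.pow_le_pow_right Fintype.card_pos (finrank_ker_aeval_frobEnd_le hfm)
  have hker (α : E) (hα : (aeval (frobEnd F E) f).toAddMonoidHom α = 0) :
      ∃ P ∈ monicFactors T, ψ P α = 1 := by
    obtain ⟨P, hP, hPg⟩ : ∃ P ∈ monicFactors T, P ∣ (X ^ Module.finrank F E - 1) / f := by
      have hg := gcd_isUnit_iff (((X : F[X]) ^ Module.finrank F E - 1) / f) T
      obtain ⟨P, hP, hPd⟩ := exists_mem_monicFactors_dvd hT0
        (gcd_dvd_right (((X : F[X]) ^ Module.finrank F E - 1) / f) T) (mt hg.1 hncop)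
      exact ⟨P, hP, hPd.trans (gcd_dvd_left _ _)⟩
    refine ⟨P, hP, ?_⟩
    obtain ⟨β, rfl⟩ := ker_aeval_frobEnd_le_range hfm
      (EuclideanDomain.mul_div_cancel' hfm.ne_zero hfd) (LinearMap.mem_ker.2 hα)
    obtain ⟨R, hR⟩ := hPg
    rw [hR, map_mul, Module.End.mul_apply]
    exact (hψ P hP).2 _
  have hsize : (2 : ℝ) ^ m.primeFactors.card * 2 ^ (monicFactors T).card
      * Nat.card (aeval (frobEnd F E) f).toAddMonoidHom.ker ≤ √(Fintype.card E) := by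
    have hq : (0 : ℝ) < Fintype.card F := by exact_mod_cast Fintype.card_pos
    calc _ ≤ (Wnat m : ℝ) * Wpoly T * (Fintype.card F : ℝ) ^ k := by
          gcongr
          · exact_mod_cast two_pow_card_primeFactors_le_Wnat hm.ne'
          · exact_mod_cast two_pow_card_monicFactors_le_Wpoly hT0
          · exact_mod_cast hcardker
      _ ≤ (Fintype.card F : ℝ) ^ ((Module.finrank F E : ℝ) / 2 - k) * (Fintype.card F : ℝ) ^ k := by
          gcongr
      _ = √(Fintype.card E) := by
          rw [← Real.rpow_natCast _ k, ← Real.rpow_add hq, sub_add_cancel, hE, Nat.cast_pow,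
            Real.sqrt_eq_rpow, ← Real.rpow_natCast, ← Real.rpow_mul hq.le, mul_one_div]
  obtain ⟨α, hα0, hαψ, hαχ⟩ := exists_prod_one_sub_ne_zero (monicFactors T) m.primeFactors ψ χ
    (aeval (frobEnd F E) f).toAddMonoidHom
    (fun S hS hne ↦ prod_addChar_ne_one hne
      ((pairwise_isCoprime_monicFactors hT0).mono (Finset.coe_subset.2 hS))
      fun P hP ↦ hψ P (hS hP))
    (fun S hS hne ↦ prod_mulChar_ne_one hne
      (fun p hp ↦ Nat.prime_of_mem_primeFactors (hS hp)) fun p hp ↦ hχ p (hS hp))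
    hker hsize
  have hLf : Lf (Fintype.card F) f α = (aeval (frobEnd F E) f).toAddMonoidHom α := Lf_eq_aeval f α
  rw [Nf, Nat.card_pos_iff]
  refine ⟨⟨α, fun h hhm hhT ⟨β, hβ⟩ ↦ ?_, hLf ▸ hα0, fun d hd ⟨β, hβ⟩ ↦ ?_⟩, inferInstance⟩
  · by_contra hne
    obtain ⟨P, hP, R, rfl⟩ := exists_mem_monicFactors_dvd hT0 hhT
      fun hu ↦ hne (hhm.eq_one_of_isUnit hu)
    refine hαψ P hP ?_
    rw [← hβ, Lf_eq_aeval, map_mul, Module.End.mul_apply]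
    exact (hψ P hP).2 _
  · by_contra hne
    have hp := Nat.minFac_prime hne
    have hpm : d.minFac ∈ m.primeFactors :=
      Nat.mem_primeFactors.2 ⟨hp, (Nat.minFac_dvd d).trans hd, hm.ne'⟩
    refine hαχ _ hpm ?_
    have hd0 : d ≠ 0 := ne_zero_of_dvd_ne_zero hm.ne' hd
    have hβ0 : β ≠ 0 := by
      rintro rfl
      exact hα0 (by rw [← hLf, hβ, zero_pow hd0])
    have hone : χ d.minFac ^ d.minFac = 1 :=
      orderOf_dvd_iff_pow_eq_one.1 (hχ _ hpm).dvd
    have hβd : β ^ d = (β ^ (d / d.minFac)) ^ d.minFac := by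
      rw [← pow_mul, Nat.div_mul_cancel (Nat.minFac_dvd d)]
    rw [← hLf, hβ, hβd, map_pow,
      ← MulChar.pow_apply' _ hp.ne_zero, hone, MulChar.one_apply (pow_ne_zero _ hβ0).isUnit]

end
end
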